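/- arXiv:1605.09255 — 3 statements merged into one kernel-verified Lean document; each statement's English description precedes it below -/
import Mathlib

section
/- Let A have finite global dimension d and let P be a 2-term silting complex in K^b(proj A) such that the A-module H^0(P) has projective dimension at most 1, so that Q = H^{-1}(P) is a projective A-module. Let tQ be the torsion submodule of Q with respect to the torsion pair (T(P), F(P)). Then tQ lies in add H^0(P) * add H^0(P)[1] * ... * add H^0(P)[d-1]. -/
/-!
Common setup: we model right `A`-modules as `ModuleCat Aᵐᵒᵖ`, the bounded derived
category `D^b(mod A)` as the full subcategory (given by the predicate `InDb`) of the
derived category of `Mod Aᵐᵒᵖ` consisting of cohomologically bounded complexes with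
finitely generated cohomology, and `K^b(proj A)` via bounded complexes of finitely
generated projective modules (`IsPerfCplx`).
-/

namespace TwoTermSilting

open CategoryTheory Limits Pretriangulated

universe w v u

noncomputable section

/-- The projective dimension of the module `M` is at most `n`. -/
def pdLE (R : Type u) [Ring R] : ℕ → ModuleCat.{v} R → Prop
  | 0, M => Projective M
  | (n+1), M => ∃ (P : ModuleCat.{v} R) (f : P ⟶ M),
      Projective P ∧ Epi f ∧ pdLE R n (kernel f)

/-- The (right) global dimension of `R` is at most `d`: every finitely generated
module has projective dimension at most `d`. -/
def gldLE (R : Type u) [Ring R] (d : ℕ) : Prop :=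
  ∀ M : ModuleCat.{v} R, Module.Finite R M → pdLE R d M

section Star

variable {C : Type u} [Category.{v} C] [HasZeroObject C] [Preadditive C] [HasShift C ℤ]
  [∀ n : ℤ, (shiftFunctor C n).Additive] [Pretriangulated C]

/-- `star S T` consists of the objects `Z` sitting in a distinguished triangle
`X ⟶ Z ⟶ Y ⟶ X⟦1⟧` with `X ∈ S` and `Y ∈ T`. -/
def star (S T : Set C) : Set C :=
  {Z | ∃ (X Y : C) (f : X ⟶ Z) (g : Z ⟶ Y) (h : Y ⟶ X⟦(1 : ℤ)⟧),
    X ∈ S ∧ Y ∈ T ∧ Triangle.mk f g h ∈ distTriang C}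

/-- `starChain f n` is the iterated star product `f 0 * f 1 * ⋯ * f n`
(the star operation being associative). -/
def starChain (f : ℕ → Set C) : ℕ → Set C
  | 0 => f 0
  | (n+1) => star (starChain f n) (f (n+1))

/-- The closure of a class of objects under the shift by `n`. -/
def shiftSet (S : Set C) (n : ℤ) : Set C :=
  {Y | ∃ X ∈ S, Nonempty (Y ≅ X⟦n⟧)}

/-- The additive closure of the object `X`: all direct summands of finite direct sums
of copies of `X`. -/
def addOf (X : C) : Set C :=
  {Y | ∃ (n : ℕ) (ι : Y ⟶ ⨁ (fun _ : Fin n => X)) (r : (⨁ (fun _ : Fin n => X)) ⟶ Y),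
    ι ≫ r = 𝟙 Y}

/-- A class of objects of a (pre)triangulated category is thick if it is closed under
isomorphisms, shifts, extensions and direct summands. -/
def IsThick (S : Set C) : Prop :=
  (∀ ⦃X Y : C⦄, (X ≅ Y) → X ∈ S → Y ∈ S) ∧
  (∀ (X : C) (n : ℤ), X ∈ S → (X⟦n⟧) ∈ S) ∧
  (∀ T : Triangle C, (T ∈ distTriang C) → T.obj₁ ∈ S → T.obj₃ ∈ S → T.obj₂ ∈ S) ∧
  (∀ (X Y : C) (ι : X ⟶ Y) (r : Y ⟶ X), ι ≫ r = 𝟙 X → Y ∈ S → X ∈ S)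

end Star

/-- The right `End Y`-module structure on `Y ⟶ X`, by precomposition. -/
instance endModule {C : Type u} [Category.{v} C] [Preadditive C] (Y X : C) :
    Module (End Y)ᵐᵒᵖ (Y ⟶ X) where
  smul b f := b.unop ≫ f
  one_smul f := Category.id_comp f
  mul_smul b₁ b₂ f := by
    show (b₁ * b₂).unop ≫ f = b₁.unop ≫ (b₂.unop ≫ f)
    have h : (b₁ * b₂).unop = b₁.unop ≫ b₂.unop := rfl
    rw [h, Category.assoc]
  smul_zero b := Limits.comp_zero
  smul_add b f g := Preadditive.comp_add _ _ _ _ _ _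
  add_smul b₁ b₂ f := Preadditive.add_comp _ _ _ _ _ _
  zero_smul f := Limits.zero_comp

section Main

variable (R : Type) [Ring R] [HasDerivedCategory.{w} (ModuleCat.{0} R)]

/-- A bounded complex of finitely generated projective modules
(an object of `K^b(proj R)`). -/
def IsPerfCplx (X : CochainComplex (ModuleCat.{0} R) ℤ) : Prop :=
  (∀ i, Projective (X.X i)) ∧ (∀ i, Module.Finite R (X.X i)) ∧
    ∃ a b : ℤ, ∀ i, (i < a ∨ b < i) → IsZero (X.X i)

/-- A complex of finitely generated projective modules concentrated in
degrees `-1` and `0`. -/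
def IsTwoTermCplx (X : CochainComplex (ModuleCat.{0} R) ℤ) : Prop :=
  (∀ i, Projective (X.X i)) ∧ (∀ i, Module.Finite R (X.X i)) ∧
    ∀ i, i ≠ -1 → i ≠ 0 → IsZero (X.X i)

/-- A two-term silting complex: a two-term complex of finitely generated projectives `P`
with `Hom_D(P, P[1]) = 0`, such that the smallest thick subcategory containing `P`
contains all of `K^b(proj R)`. -/
def IsTwoTermSilting (P : CochainComplex (ModuleCat.{0} R) ℤ) : Prop :=
  IsTwoTermCplx R P ∧
  (∀ f : DerivedCategory.Q.obj P ⟶ (DerivedCategory.Q.obj P)⟦(1 : ℤ)⟧, f = 0) ∧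
  (∀ S : Set (DerivedCategory (ModuleCat.{0} R)), IsThick S →
    DerivedCategory.Q.obj P ∈ S →
    ∀ X : CochainComplex (ModuleCat.{0} R) ℤ, IsPerfCplx R X → DerivedCategory.Q.obj X ∈ S)

/-- The objects of the derived category which belong to `D^b(mod R)`: cohomologically
bounded complexes with finitely generated cohomology. -/
def InDb (X : DerivedCategory (ModuleCat.{0} R)) : Prop :=
  (∃ a b : ℤ, ∀ i, (i < a ∨ b < i) →
    IsZero ((DerivedCategory.homologyFunctor (ModuleCat.{0} R) i).obj X)) ∧
  (∀ i : ℤ, Module.Finite R ((DerivedCategory.homologyFunctor (ModuleCat.{0} R) i).obj X))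

variable {R}

/-- The torsion class `T(P)` of finitely generated modules `X` with `Hom_D(P, X[1]) = 0`. -/
def TT (P : CochainComplex (ModuleCat.{0} R) ℤ) : Set (ModuleCat.{0} R) :=
  {X | Module.Finite R X ∧
    ∀ f : DerivedCategory.Q.obj P ⟶
      ((DerivedCategory.singleFunctor (ModuleCat.{0} R) 0).obj X)⟦(1 : ℤ)⟧, f = 0}

/-- The torsion-free class `F(P)` of finitely generated modules `Y` with `Hom_D(P, Y) = 0`. -/
def FF (P : CochainComplex (ModuleCat.{0} R) ℤ) : Set (ModuleCat.{0} R) :=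
  {Y | Module.Finite R Y ∧
    ∀ f : DerivedCategory.Q.obj P ⟶
      (DerivedCategory.singleFunctor (ModuleCat.{0} R) 0).obj Y, f = 0}

/-- The heart `C(P) = {X ∈ D^b(mod R) | Hom_D(P, X[i]) = 0 for all i ≠ 0}`. -/
def CP (P : CochainComplex (ModuleCat.{0} R) ℤ) : Set (DerivedCategory (ModuleCat.{0} R)) :=
  {X | InDb R X ∧ ∀ i : ℤ, i ≠ 0 → ∀ f : DerivedCategory.Q.obj P ⟶ X⟦i⟧, f = 0}

end Main

section ExtVanishing

open Abelian (Ext)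

attribute [local instance] Abelian.hasFiniteBiproducts

variable {C : Type u} [Category.{v} C] [Abelian C]

lemma shortExact_kernel {X Y : C} (f : X ⟶ Y) [Epi f] :
    (ShortComplex.mk (kernel.ι f) f (kernel.condition f)).ShortExact where
  exact := ShortComplex.exact_kernel f

variable [HasExt.{w} C]

lemma subsingleton_ext_one_of_epi {M X Y : C} [HasProjectiveDimensionLT M 2] (f : X ⟶ Y) [Epi f]
    (h : Subsingleton (Ext M X 1)) : Subsingleton (Ext M Y 1) := by
  refine subsingleton_of_forall_eq 0 fun y => ?_
  obtain ⟨x, rfl⟩ := Ext.covariant_sequence_exact₃ M (shortExact_kernel f) y (n₁ := 2) rfl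
    (Ext.eq_zero_of_hasProjectiveDimensionLT _ 2 le_rfl)
  rw [Subsingleton.elim x 0, Ext.zero_comp]

lemma hom_cokernel_eq_zero {M W X : C} [HasProjectiveDimensionLT M 2] (f : W ⟶ X)
    (hf : ∀ g : M ⟶ X, ∃ g', g' ≫ f = g) (hW : Subsingleton (Ext M W 1))
    (g : M ⟶ cokernel f) : g = 0 := by
  have := subsingleton_ext_one_of_epi (Abelian.factorThruImage f) hW
  obtain ⟨x, hx⟩ := Ext.covariant_sequence_exact₃ M (shortExact_kernel (cokernel.π f))
    (Ext.mk₀ g) (n₁ := 1) rfl (this.elim _ _)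
  obtain ⟨x, rfl⟩ := (Ext.mk₀_bijective _ _).2 x
  obtain ⟨x, rfl⟩ := hf x
  rw [Ext.mk₀_comp_mk₀] at hx
  rw [← (Ext.mk₀_bijective _ _).1 hx]
  simp

lemma subsingleton_ext_one_kernel {M W X : C} (f : W ⟶ X) [Epi f]
    (hf : ∀ g : M ⟶ X, ∃ g', g' ≫ f = g) (hW : Subsingleton (Ext M W 1)) :
    Subsingleton (Ext M (kernel f) 1) := by
  refine subsingleton_of_forall_eq 0 fun y => ?_
  obtain ⟨x, rfl⟩ := Ext.covariant_sequence_exact₁ M (shortExact_kernel f) y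
    (hW.elim _ _) (n₀ := 0) rfl
  obtain ⟨x, rfl⟩ := (Ext.mk₀_bijective _ _).2 x
  obtain ⟨x, rfl⟩ := hf x
  rw [← Ext.mk₀_comp_mk₀, Ext.comp_assoc_of_second_deg_zero,
    (shortExact_kernel f).comp_extClass, Ext.comp_zero]

lemma subsingleton_ext_biproduct {M X : C} (n r : ℕ) (h : Subsingleton (Ext X M r)) :
    Subsingleton (Ext X (⨁ fun _ : Fin n => M) r) :=
  (Ext.addEquivBiproduct X (biproduct.isBilimit _) r).subsingleton

lemma subsingleton_ext_of_biproduct {M Y : C} (n r : ℕ) (h : Subsingleton (Ext M Y r)) :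
    Subsingleton (Ext (⨁ fun _ : Fin n => M) Y r) :=
  (Ext.biproductAddEquiv (biproduct.isBilimit _) Y r).subsingleton

lemma subsingleton_ext_kernel {W X Y : C} (f : W ⟶ X) [Epi f] (n : ℕ)
    (hW : Subsingleton (Ext W Y n)) (hX : Subsingleton (Ext X Y (n + 1))) :
    Subsingleton (Ext (kernel f) Y n) := by
  refine subsingleton_of_forall_eq 0 fun y => ?_
  obtain ⟨x, rfl⟩ := Ext.contravariant_sequence_exact₁ (shortExact_kernel f) Y y
    (n₁ := n + 1) (add_comm _ _) (hX.elim _ _)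
  rw [hW.elim x 0, Ext.comp_zero]

lemma exists_section_of_subsingleton_ext {W X : C} (f : W ⟶ X) [Epi f]
    (h : Subsingleton (Ext X (kernel f) 1)) : ∃ s, s ≫ f = 𝟙 X := by
  obtain ⟨x, hx⟩ := Ext.covariant_sequence_exact₃ X (shortExact_kernel f)
    (Ext.mk₀ (𝟙 X)) (n₁ := 1) rfl (h.elim _ _)
  obtain ⟨x, rfl⟩ := (Ext.mk₀_bijective _ _).2 x
  rw [Ext.mk₀_comp_mk₀] at hx
  exact ⟨x, (Ext.mk₀_bijective _ _).1 hx⟩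

end ExtVanishing

lemma hasProjectiveDimensionLT_of_pdLE {R : Type u} [Ring R] {n : ℕ} {M : ModuleCat.{v} R}
    (h : pdLE R n M) : HasProjectiveDimensionLT M (n + 1) := by
  induction n generalizing M with
  | zero => exact projective_iff_hasProjectiveDimensionLT_one.1 h
  | succ n ih =>
    obtain ⟨P, f, hP, hf, hk⟩ := h
    exact (shortExact_kernel f).hasProjectiveDimensionLT_X₃ _ (ih hk)
      (inferInstanceAs (HasProjectiveDimensionLT P (n + 1 + 1)))

section Derived

variable {C : Type u} [Category.{v} C] [Abelian C] [HasDerivedCategory.{w} C]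

open DerivedCategory
open Abelian (Ext)

attribute [local instance] Abelian.hasFiniteBiproducts

lemma star_star_subset {C : Type u} [Category.{v} C] [HasZeroObject C] [Preadditive C]
    [HasShift C ℤ] [∀ n : ℤ, (shiftFunctor C n).Additive] [Pretriangulated C] [IsTriangulated C]
    (S T U : Set C) : star S (star T U) ⊆ star (star S T) U := by
  rintro X ⟨A, Z, f, g, h, hA, ⟨B, D, f', g', h', hB, hD, hT'⟩, hT⟩
  obtain ⟨Y, f'', h'', hT''⟩ := distinguished_cocone_triangle₁ (g ≫ g')
  exact ⟨_, _, _, _, _, ⟨_, _, _, _, _, hA, hB,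
    (Triangulated.someOctahedron' rfl hT hT' hT'').mem⟩, hD, hT''⟩

lemma star_starChain_subset {C : Type u} [Category.{v} C] [HasZeroObject C] [Preadditive C]
    [HasShift C ℤ] [∀ n : ℤ, (shiftFunctor C n).Additive] [Pretriangulated C] [IsTriangulated C]
    (f : ℕ → Set C) (n : ℕ) :
    star (f 0) (starChain (fun i => f (i + 1)) n) ⊆ starChain f (n + 1) := by
  induction n with
  | zero => exact subset_rfl
  | succ n ih =>
    refine (star_star_subset _ _ _).trans ?_
    rintro X ⟨Y, Z, a, b, c, hY, hZ, hT⟩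
    exact ⟨Y, Z, a, b, c, ih hY, hZ, hT⟩

lemma mem_star_of_iso {C : Type u} [Category.{v} C] [HasZeroObject C] [Preadditive C]
    [HasShift C ℤ] [∀ n : ℤ, (shiftFunctor C n).Additive] [Pretriangulated C] {S T : Set C}
    {A : Triangle C} (hA : A ∈ distTriang C) {Y : C} (e : A.obj₃ ≅ Y) (hS : A.obj₁ ∈ S)
    (hT : Y ∈ T) : A.obj₂ ∈ star S T :=
  ⟨A.obj₁, Y, A.mor₁, A.mor₂ ≫ e.hom, e.inv ≫ A.mor₃, hS, hT, isomorphic_distinguished _ hA _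
    (Triangle.isoMk (Triangle.mk A.mor₁ (A.mor₂ ≫ e.hom) (e.inv ≫ A.mor₃)) A
      (Iso.refl A.obj₁) (Iso.refl A.obj₂) e.symm
      ((Category.comp_id _).trans (Category.id_comp _).symm)
      (by change (A.mor₂ ≫ e.hom) ≫ e.inv = 𝟙 _ ≫ A.mor₂; simp)
      (by change (e.inv ≫ A.mor₃) ≫ (𝟙 _)⟦1⟧' = e.inv ≫ A.mor₃; simp))⟩

lemma singleFunctor_obj_mem_addOf {M X : C} {n : ℕ} (ι : X ⟶ ⨁ fun _ : Fin n => M)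
    (r : (⨁ fun _ : Fin n => M) ⟶ X) (h : ι ≫ r = 𝟙 X) :
    (singleFunctor C 0).obj X ∈ addOf ((singleFunctor C 0).obj M) := by
  let e := (singleFunctor C 0).mapBiproduct (fun _ : Fin n => M)
  refine ⟨n, (singleFunctor C 0).map ι ≫ e.hom, e.inv ≫ (singleFunctor C 0).map r, ?_⟩
  rw [Category.assoc, e.hom_inv_id_assoc, ← Functor.map_comp, h, CategoryTheory.Functor.map_id]

lemma shift_mem_starChain_of_approx [HasExt.{w} C] {M : C} [HasProjectiveDimensionLT M 2]
    (T : C → Prop) (hT : ∀ X, T X → Subsingleton (Ext M X 1))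
    (happ : ∀ X, T X → ∃ (n : ℕ) (f : (⨁ fun _ : Fin n => M) ⟶ X), Epi f ∧ T (kernel f))
    (n : ℕ) (X : C) (hX : T X) (hXn : ∀ Y, T Y → Subsingleton (Ext X Y (n + 1))) (m : ℤ) :
    ((singleFunctor C 0).obj X)⟦m⟧ ∈
      starChain (fun i => shiftSet (addOf ((singleFunctor C 0).obj M)) (m + (i : ℤ))) n := by
  induction n generalizing X m with
  | zero =>
    obtain ⟨r, f, hf, hK⟩ := happ X hX
    obtain ⟨s, hs⟩ := exists_section_of_subsingleton_ext f (hXn _ hK)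
    exact ⟨_, singleFunctor_obj_mem_addOf s f hs, ⟨eqToIso (by simp)⟩⟩
  | succ n ih =>
    obtain ⟨r, f, hf, hK⟩ := happ X hX
    have key := ih (kernel f) hK (fun Y hY => subsingleton_ext_kernel f (n + 1)
      (subsingleton_ext_of_biproduct _ _ (by
        obtain _ | n := n
        · exact hT Y hY
        · exact HasProjectiveDimensionLT.subsingleton M 2 _ (by lia) Y)) (hXn Y hY)) (m + 1)
    apply star_starChain_subset
    have hd := Triangle.shift_distinguished _
      (rot_of_distTriang _ (shortExact_kernel f).singleTriangle_distinguished) m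
    refine mem_star_of_iso hd ((shiftFunctorAdd' _ 1 m (m + 1) (add_comm _ _)).symm.app _)
      ⟨_, singleFunctor_obj_mem_addOf (𝟙 _) (𝟙 _) (Category.id_comp _), ⟨eqToIso (by simp; rfl)⟩⟩ ?_
    convert key using 4
    · push_cast
      ring
    · rfl

lemma mem_starChain_of_iso {C : Type u} [Category.{v} C] [HasZeroObject C] [Preadditive C]
    [HasShift C ℤ] [∀ n : ℤ, (shiftFunctor C n).Additive] [Pretriangulated C] {S : ℕ → Set C}
    {a : ℕ → ℤ} {n : ℕ} {X Y : C} (e : X ≅ Y)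
    (hX : X ∈ starChain (fun i => shiftSet (S i) (a i)) n) :
    Y ∈ starChain (fun i => shiftSet (S i) (a i)) n := by
  obtain _ | n := n
  · obtain ⟨Z, hZ, ⟨e'⟩⟩ := hX
    exact ⟨Z, hZ, ⟨e.symm ≪≫ e'⟩⟩
  · obtain ⟨A, B, f, g, h, hA, hB, hT⟩ := hX
    exact ⟨A, B, f ≫ e.hom, e.inv ≫ g, h, hA, hB, isomorphic_distinguished _ hT _
      (Triangle.isoMk (Triangle.mk (f ≫ e.hom) (e.inv ≫ g) h) (Triangle.mk f g h)
        (Iso.refl A) e.symm (Iso.refl B)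
        (by change (f ≫ e.hom) ≫ e.inv = 𝟙 _ ≫ f; simp)
        (by change (e.inv ≫ g) ≫ 𝟙 _ = e.inv ≫ g; simp)
        (by change h ≫ (𝟙 _)⟦1⟧' = 𝟙 _ ≫ h; simp))⟩

lemma exists_triangle_singleFunctor (K : DerivedCategory C) [K.IsGE (-1)] [K.IsLE 0] :
    ∃ (f : ((singleFunctor C 0).obj ((homologyFunctor C (-1)).obj K))⟦(1 : ℤ)⟧ ⟶ K)
      (g : K ⟶ (singleFunctor C 0).obj ((homologyFunctor C 0).obj K))
      (h : _ ⟶ (((singleFunctor C 0).obj ((homologyFunctor C (-1)).obj K))⟦(1 : ℤ)⟧)⟦(1 : ℤ)⟧),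
      Triangle.mk f g h ∈ distTriang (DerivedCategory C) := by
  obtain ⟨X, Y, hX, hY, f, g, h, hT⟩ := TStructure.t.exists_triangle K (-1) 0 rfl
  have : X.IsLE (-1) := ⟨hX⟩
  have : Y.IsGE 0 := ⟨hY⟩
  have : X.IsGE (-1) := by
    rw [isGE_iff]
    exact fun i hi => (HomologySequence.exact₁ _ hT (i - 1) i).isZero_X₂
      ((Y.isZero_of_isGE 0 (i - 1) (by lia)).eq_of_src _ _)
      ((K.isZero_of_isGE (-1) i hi).eq_of_tgt _ _)
  have : Y.IsLE 0 := by
    rw [isLE_iff]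
    exact fun i hi => (HomologySequence.exact₃ _ hT i (i + 1)).isZero_X₂
      ((K.isZero_of_isLE 0 i hi).eq_of_src _ _)
      ((X.isZero_of_isLE (-1) (i + 1) (by lia)).eq_of_tgt _ _)
  have : Mono ((homologyFunctor C (-1)).map f) :=
    (HomologySequence.mono_homologyMap_mor₁_iff _ hT (-2) (-1)).2
      ((Y.isZero_of_isGE 0 (-2) (by lia)).eq_of_src _ _)
  have : Epi ((homologyFunctor C (-1)).map f) :=
    (HomologySequence.epi_homologyMap_mor₁_iff _ hT (-1)).2
      ((Y.isZero_of_isGE 0 (-1) (by lia)).eq_of_tgt _ _)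
  have : Mono ((homologyFunctor C 0).map g) :=
    (HomologySequence.mono_homologyMap_mor₂_iff _ hT 0).2
      ((X.isZero_of_isLE (-1) 0 (by lia)).eq_of_src _ _)
  have : Epi ((homologyFunctor C 0).map g) :=
    (HomologySequence.epi_homologyMap_mor₂_iff _ hT 0 1).2
      ((X.isZero_of_isLE (-1) 1 (by lia)).eq_of_tgt _ _)
  have : IsIso ((homologyFunctor C (-1)).map f) := isIso_of_mono_of_epi _
  have : IsIso ((homologyFunctor C 0).map g) := isIso_of_mono_of_epi _
  obtain ⟨X', ⟨eX⟩⟩ := exists_iso_singleFunctor_obj_of_isGE_of_isLE X (-1)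
  obtain ⟨Y', ⟨eY⟩⟩ := exists_iso_singleFunctor_obj_of_isGE_of_isLE Y 0
  let e₁ : X' ≅ (homologyFunctor C (-1)).obj K :=
    ((singleFunctorCompHomologyFunctorIso C (-1)).app X').symm ≪≫
      (homologyFunctor C (-1)).mapIso eX.symm ≪≫ asIso ((homologyFunctor C (-1)).map f)
  let e₃ : Y' ≅ (homologyFunctor C 0).obj K :=
    ((singleFunctorCompHomologyFunctorIso C 0).app Y').symm ≪≫
      (homologyFunctor C 0).mapIso eY.symm ≪≫ (asIso ((homologyFunctor C 0).map g)).symm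
  let i₁ : ((singleFunctor C 0).obj ((homologyFunctor C (-1)).obj K))⟦(1 : ℤ)⟧ ≅ X :=
    ((singleFunctors C).shiftIso 1 (-1) 0 (by simp)).app _ ≪≫
      (singleFunctor C (-1)).mapIso e₁.symm ≪≫ eX.symm
  let i₃ : (singleFunctor C 0).obj ((homologyFunctor C 0).obj K) ≅ Y :=
    (singleFunctor C 0).mapIso e₃.symm ≪≫ eY.symm
  refine ⟨i₁.hom ≫ f, g ≫ i₃.inv, i₃.hom ≫ h ≫ i₁.inv⟦(1 : ℤ)⟧',
    isomorphic_distinguished _ hT _ (Triangle.isoMk _ (Triangle.mk f g h) i₁ (Iso.refl K) i₃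
      ?_ ?_ ?_)⟩
  · change (i₁.hom ≫ f) ≫ 𝟙 _ = i₁.hom ≫ f
    simp
  · change (g ≫ i₃.inv) ≫ i₃.hom = 𝟙 _ ≫ g
    simp
  · change (i₃.hom ≫ h ≫ i₁.inv⟦(1 : ℤ)⟧') ≫ i₁.hom⟦(1 : ℤ)⟧' = i₃.hom ≫ h
    simp [← Functor.map_comp]

lemma singleFunctor_hom_eq_zero [HasExt.{w} C] {X Y : C} (i : ℤ)
    (hE : ∀ n : ℕ, (n : ℤ) = i → Subsingleton (Ext X Y n))
    (f : (singleFunctor C 0).obj X ⟶ ((singleFunctor C 0).obj Y)⟦i⟧) : f = 0 := by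
  obtain hi | hi := lt_or_ge i 0
  · have := TStructure.t.isGE_shift ((singleFunctor C 0).obj Y) 0 i (-i)
    exact TStructure.t.zero f 0 (-i)
  · lift i to ℕ using hi
    have := hE i rfl
    exact (Ext.homEquiv (X := X) (Y := Y) (n := i)).symm.subsingleton.elim f 0

lemma hom_eq_zero_of_iso [HasExt.{w} C] {X Y : C} {W Z : DerivedCategory C} (a b : ℤ)
    (eW : W ≅ ((singleFunctor C 0).obj X)⟦a⟧) (eZ : Z ≅ ((singleFunctor C 0).obj Y)⟦b⟧)
    (hE : ∀ n : ℕ, (n : ℤ) = b - a → Subsingleton (Ext X Y n)) (f : W ⟶ Z) : f = 0 := by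
  let e := eZ ≪≫ (shiftFunctorAdd' (DerivedCategory C) (b - a) a b (by simp)).app _
  obtain ⟨g, hg⟩ := (shiftFunctor (DerivedCategory C) a).map_surjective (eW.inv ≫ f ≫ e.hom)
  rw [singleFunctor_hom_eq_zero _ hE g, Functor.map_zero] at hg
  rw [← cancel_epi eW.inv, ← cancel_mono e.hom, Category.assoc, ← hg, comp_zero, zero_comp]

lemma isThick_setOf_hom_eq_zero {D : Type u} [Category.{v} D] [HasZeroObject D] [Preadditive D]
    [HasShift D ℤ] [∀ n : ℤ, (shiftFunctor D n).Additive] [Pretriangulated D] (Z : D) :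
    IsThick {Y : D | ∀ (i : ℤ) (f : Y ⟶ Z⟦i⟧), f = 0} := by
  refine ⟨fun X Y e hX i f => ?_, fun X n hX i f => ?_, fun T hT h₁ h₃ i f => ?_,
    fun X Y s r h hY i f => ?_⟩
  · rw [← cancel_epi e.hom, hX i (e.hom ≫ f), comp_zero]
  · obtain ⟨g, hg⟩ := (shiftFunctor D n).map_surjective
      (f ≫ (shiftFunctorAdd' D (i - n) n i (by simp)).hom.app _)
    rw [hX _ g, Functor.map_zero] at hg
    rw [← cancel_mono ((shiftFunctorAdd' D (i - n) n i (by simp)).hom.app _), ← hg, zero_comp]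
  · obtain ⟨g, rfl⟩ := Triangle.yoneda_exact₂ T hT f (h₁ i _)
    rw [h₃ i g, comp_zero]
  · rw [← Category.id_comp f, ← h, Category.assoc, hY i (r ≫ f), comp_zero]

section Triangle

variable {T : Triangle (DerivedCategory C)} (hT : T ∈ distTriang (DerivedCategory C)) {M Q' : C}
  (e₁ : T.obj₁ ≅ ((singleFunctor C 0).obj Q')⟦(1 : ℤ)⟧) (e₃ : T.obj₃ ≅ (singleFunctor C 0).obj M)

include hT e₁ e₃

lemma hom_eq_zero_of_triangle [HasExt.{w} C] {Y : C} {Z : DerivedCategory C} (i : ℤ)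
    (e : Z ≅ ((singleFunctor C 0).obj Y)⟦i⟧)
    (hM : ∀ n : ℕ, (n : ℤ) = i → Subsingleton (Ext M Y n))
    (hQ : ∀ n : ℕ, (n : ℤ) = i - 1 → Subsingleton (Ext Q' Y n))
    (x : T.obj₂ ⟶ Z) : x = 0 := by
  obtain ⟨y, rfl⟩ := Triangle.yoneda_exact₂ _ hT x (hom_eq_zero_of_iso 1 i e₁ e hQ _)
  rw [hom_eq_zero_of_iso 0 i
    (e₃ ≪≫ (shiftFunctorZero (DerivedCategory C) ℤ).symm.app _) e (by simpa using hM) y, comp_zero]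

lemma hom_shift_obj₃_eq_zero [HasExt.{w} C] [HasProjectiveDimensionLT M 2] [Projective Q']
    (hK : ∀ x : T.obj₂ ⟶ T.obj₂⟦(1 : ℤ)⟧, x = 0) (x : T.obj₂ ⟶ T.obj₃⟦(1 : ℤ)⟧) : x = 0 := by
  have hx : x ≫ T.mor₃⟦(1 : ℤ)⟧' = 0 := hom_eq_zero_of_triangle hT e₁ e₃ (Y := Q') 3
    ((shiftFunctor (DerivedCategory C) (1 : ℤ)).mapIso
      ((shiftFunctor (DerivedCategory C) (1 : ℤ)).mapIso e₁ ≪≫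
        (shiftFunctorAdd' (DerivedCategory C) (1 : ℤ) 1 2 rfl).symm.app _) ≪≫
        (shiftFunctorAdd' (DerivedCategory C) (2 : ℤ) 1 3 rfl).symm.app _)
    (fun n hn => HasProjectiveDimensionLT.subsingleton M 2 _ (by lia) _)
    (fun n hn => HasProjectiveDimensionLT.subsingleton Q' 1 _ (by lia) _) _
  obtain ⟨y, rfl⟩ := Triangle.coyoneda_exact₁ _
    (rot_of_distTriang _ (rot_of_distTriang _ hT)) x hx
  exact (congrArg (· ≫ _) (hK y)).trans zero_comp

lemma subsingleton_ext_of_hom_eq_zero [HasExt.{w} C] {X : C}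
    (hX : ∀ x : T.obj₂ ⟶ ((singleFunctor C 0).obj X)⟦(1 : ℤ)⟧, x = 0) :
    Subsingleton (Ext M X 1) := by
  suffices ∀ e : T.obj₃ ⟶ ((singleFunctor C 0).obj X)⟦(1 : ℤ)⟧, e = 0 by
    refine Ext.homEquiv.subsingleton_congr.2 (subsingleton_of_forall_eq 0 fun e => ?_)
    exact (cancel_epi e₃.hom).1 ((this (e₃.hom ≫ e)).trans comp_zero.symm)
  intro e
  obtain ⟨y, rfl⟩ := Triangle.yoneda_exact₃ _ hT e (hX _)
  rw [hom_eq_zero_of_iso (X := Q') (Y := X) 2 1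
    ((shiftFunctor (DerivedCategory C) (1 : ℤ)).mapIso e₁ ≪≫
      (shiftFunctorAdd' (DerivedCategory C) (1 : ℤ) 1 2 rfl).symm.app _) (Iso.refl _)
    (fun n hn => by lia) y, comp_zero]

lemma hom_eq_zero_of_hom_eq_zero [HasExt.{w} C] [HasProjectiveDimensionLT M 2] {X : C}
    (hX : ∀ x : T.obj₂ ⟶ ((singleFunctor C 0).obj X)⟦(1 : ℤ)⟧, x = 0) (y : Q' ⟶ X) :
    y = 0 := by
  suffices ∀ x : T.obj₁ ⟶ ((singleFunctor C 0).obj X)⟦(1 : ℤ)⟧, x = 0 by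
    apply (singleFunctor C 0).map_injective
    apply (shiftFunctor (DerivedCategory C) (1 : ℤ)).map_injective
    rw [Functor.map_zero, Functor.map_zero]
    exact (cancel_epi e₁.hom).1 ((this _).trans comp_zero.symm)
  intro x
  obtain ⟨z, rfl⟩ := Triangle.yoneda_exact₂ _ (inv_rot_of_distTriang _ hT) x
    (hom_eq_zero_of_iso (X := M) (Y := X) (-1) 1
      ((shiftFunctor (DerivedCategory C) (-1 : ℤ)).mapIso e₃) (Iso.refl _)
      (fun n hn => HasProjectiveDimensionLT.subsingleton M 2 _ (by lia) _) _)
  exact (congrArg _ (hX z)).trans comp_zero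

end Triangle

end Derived

section Modules

attribute [local instance] Abelian.hasFiniteBiproducts

variable {R : Type u} [Ring R]

lemma exists_hom_biproduct_precomp_surjective (k : Type*) [Field k] [Algebra k R]
    [Module.Finite k R] (M X : ModuleCat.{v} R) [Module.Finite R M] [Module.Finite R X] :
    ∃ (n : ℕ) (f : (⨁ fun _ : Fin n => M) ⟶ X), ∀ g : M ⟶ X, ∃ g', g' ≫ f = g := by
  let : Module k M := Module.compHom M (algebraMap k R)
  let : Module k X := Module.compHom X (algebraMap k R)
  have : IsScalarTower k R M := ⟨fun a r m => by
    rw [Algebra.smul_def, mul_smul]; rfl⟩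
  have : IsScalarTower k R X := ⟨fun a r m => by
    rw [Algebra.smul_def, mul_smul]; rfl⟩
  have : Module.Finite k M := Module.Finite.trans R M
  have : Module.Finite k X := Module.Finite.trans R X
  have : SMulCommClass R k M := IsScalarTower.to_smulCommClass'
  have : SMulCommClass R k X := IsScalarTower.to_smulCommClass'
  have : Module.Finite k (M →ₗ[R] X) :=
    Module.Finite.of_injective (LinearMap.restrictScalarsₗ k R M X k)
      (LinearMap.restrictScalars_injective k)
  obtain ⟨n, s, hs⟩ := Module.Finite.exists_fin (R := k) (M := M →ₗ[R] X)
  refine ⟨n, biproduct.desc fun i => ModuleCat.ofHom (s i), fun g => ?_⟩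
  obtain ⟨c, hc⟩ := (Submodule.mem_span_range_iff_exists_fun k).1
    (hs ▸ Submodule.mem_top : g.hom ∈ Submodule.span k (Set.range s))
  refine ⟨biproduct.lift fun i => ModuleCat.ofHom (c i • LinearMap.id), ?_⟩
  rw [biproduct.lift_desc]
  ext x
  rw [← hc]
  simp [ModuleCat.hom_sum]

lemma finite_of_epi {X Y : ModuleCat.{v} R} (f : X ⟶ Y) [Epi f] [Module.Finite R X] :
    Module.Finite R Y :=
  Module.Finite.of_surjective f.hom ((ModuleCat.epi_iff_surjective f).1 inferInstance)

lemma finite_of_mono [IsNoetherianRing R] {X Y : ModuleCat.{v} R} (f : X ⟶ Y) [Mono f]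
    [Module.Finite R Y] : Module.Finite R X :=
  Module.Finite.of_injective f.hom ((ModuleCat.mono_iff_injective f).1 inferInstance)

lemma finite_biproduct (n : ℕ) (M : ModuleCat.{v} R) [Module.Finite R M] :
    Module.Finite R (⨁ fun _ : Fin n => M : ModuleCat.{v} R) :=
  Module.Finite.equiv (ModuleCat.biproductIsoPi fun _ : Fin n => M).symm.toLinearEquiv

lemma finite_homology [IsNoetherianRing R] (K : CochainComplex (ModuleCat.{v} R) ℤ) (i : ℤ)
    [Module.Finite R (K.X i)] : Module.Finite R (K.homology i) :=
  have := finite_of_epi (K.pOpcycles i)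
  finite_of_mono (K.homologyι i)

end Modules

section Silting

open DerivedCategory
open Abelian (Ext)

attribute [local instance] Abelian.hasFiniteBiproducts

lemma projective_homology_of_projective {C : Type u} [Category.{v} C] [Abelian C]
    (K : CochainComplex C ℤ) [Projective (K.X (-1))] [Projective (K.X 0)]
    (h₀ : K.d (-2) (-1) = 0) (h₁ : K.d 0 1 = 0) [HasProjectiveDimensionLT (K.homology 0) 2] :
    Projective (K.homology (-1)) := by
  have := K.isIso_homologyπ (-2) (-1) (by simp) h₀
  have := K.isIso_homologyι 0 1 (by simp) h₁
  let e₁ : K.homology (-1) ≅ kernel (Abelian.factorThruImage (K.d (-1) 0)) :=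
    (asIso (K.homologyπ (-1))).symm ≪≫
      (K.cyclesIsKernel (-1) 0 (by simp)).conePointUniqueUpToIso (kernelIsKernel _) ≪≫
      kernelIsoOfEq (Abelian.image.fac _).symm ≪≫ kernelCompMono _ _
  let e₀ : K.homology 0 ≅ cokernel (K.d (-1) 0) :=
    asIso (K.homologyι 0) ≪≫
      (K.opcyclesIsCokernel (-1) 0 (by simp)).coconePointUniqueUpToIso (colimit.isColimit _)
  have := hasProjectiveDimensionLT_of_iso e₀ 2
  have : HasProjectiveDimensionLT (Abelian.image (K.d (-1) 0)) 1 :=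
    (shortExact_kernel (cokernel.π (K.d (-1) 0))).hasProjectiveDimensionLT_X₁ 1
      (projective_iff_hasProjectiveDimensionLT_one.1 inferInstance) this
  have h' := (shortExact_kernel (Abelian.factorThruImage (K.d (-1) 0))).hasProjectiveDimensionLT_X₁
    1 (projective_iff_hasProjectiveDimensionLT_one.1 inferInstance)
    (hasProjectiveDimensionLT_of_ge _ 1 2 (by lia))
  exact Projective.of_iso e₁.symm (projective_iff_hasProjectiveDimensionLT_one.2 h')

lemma isPerfCplx_single (R : Type) [Ring R] :
    IsPerfCplx R ((HomologicalComplex.single _ (ComplexShape.up ℤ) 0).obj (ModuleCat.of R R)) := by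
  have h (i : ℤ) (hi : i ≠ 0) := HomologicalComplex.isZero_single_obj_X (ComplexShape.up ℤ) 0
    (ModuleCat.of R R) i hi
  have e := HomologicalComplex.singleObjXSelf (ComplexShape.up ℤ) 0 (ModuleCat.of R R)
  refine ⟨fun i => ?_, fun i => ?_, 0, 0, fun i hi => h i (by lia)⟩
  · obtain rfl | hi := eq_or_ne i 0
    · exact Projective.of_iso e.symm (ModuleCat.projective_of_free (Module.Free.chooseBasis R R))
    · exact (h i hi).projective
  · obtain rfl | hi := eq_or_ne i 0
    · exact Module.Finite.equiv e.symm.toLinearEquiv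
    · have := ModuleCat.subsingleton_of_isZero (h i hi)
      infer_instance

variable {R : Type} [Ring R] [HasDerivedCategory.{w} (ModuleCat.{0} R)]

lemma isZero_of_hom_shift_eq_zero {P : CochainComplex (ModuleCat.{0} R) ℤ}
    (hP : IsTwoTermSilting R P) {X : ModuleCat.{0} R}
    (hX : ∀ (i : ℤ) (f : Q.obj P ⟶ ((singleFunctor _ 0).obj X)⟦i⟧), f = 0) : IsZero X := by
  have h := hP.2.2 _ (isThick_setOf_hom_eq_zero ((singleFunctor _ 0).obj X)) hX _
    (isPerfCplx_single R)
  have h' (f : ModuleCat.of R R ⟶ X) : f = 0 := by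
    apply (singleFunctor _ 0).map_injective
    have := h 0 ((singleFunctor _ 0).map f ≫ (shiftFunctorZero _ ℤ).inv.app _)
    rw [← cancel_mono ((shiftFunctorZero _ ℤ).inv.app _), Functor.map_zero, zero_comp]
    exact this
  have : Subsingleton X := subsingleton_of_forall_eq 0 fun x => by
    simpa using congrArg (fun f => f.hom (1 : R))
      (h' (ModuleCat.ofHom (LinearMap.toSpanSingleton R X x)))
  exact ModuleCat.isZero_of_subsingleton X

lemma exists_triangle_of_isTwoTermCplx {P : CochainComplex (ModuleCat.{0} R) ℤ}
    (hP : IsTwoTermCplx R P) :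
    ∃ (T : Triangle (DerivedCategory (ModuleCat.{0} R))) (_ : T ∈ distTriang _)
      (_ : T.obj₁ ≅ ((singleFunctor _ 0).obj (P.homology (-1)))⟦(1 : ℤ)⟧)
      (_ : T.obj₃ ≅ (singleFunctor _ 0).obj (P.homology 0)), T.obj₂ = Q.obj P := by
  have : P.IsStrictlyGE (-1) := by
    rw [CochainComplex.isStrictlyGE_iff]
    exact fun i hi => hP.2.2 i (by lia) (by lia)
  have : P.IsStrictlyLE 0 := by
    rw [CochainComplex.isStrictlyLE_iff]
    exact fun i hi => hP.2.2 i (by lia) (by lia)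
  obtain ⟨f, g, h, hT⟩ := exists_triangle_singleFunctor (Q.obj P)
  exact ⟨_, hT, (shiftFunctor _ (1 : ℤ)).mapIso ((singleFunctor _ 0).mapIso
      ((homologyFunctorFactors _ (-1)).app P)),
    (singleFunctor _ 0).mapIso ((homologyFunctorFactors _ 0).app P), rfl⟩

variable [HasExt.{w} (ModuleCat.{0} R)]

lemma exists_epi_of_isTwoTermSilting (k : Type*) [Field k] [Algebra k R] [Module.Finite k R]
    {P : CochainComplex (ModuleCat.{0} R) ℤ} (hP : IsTwoTermSilting R P)
    [HasProjectiveDimensionLT (P.homology 0) 2] [Projective (P.homology (-1))]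
    {T : Triangle (DerivedCategory (ModuleCat.{0} R))} (hT : T ∈ distTriang _)
    (e₁ : T.obj₁ ≅ ((singleFunctor _ 0).obj (P.homology (-1)))⟦(1 : ℤ)⟧)
    (e₃ : T.obj₃ ≅ (singleFunctor _ 0).obj (P.homology 0)) (hTP : T.obj₂ = Q.obj P)
    (hM : Subsingleton (Ext (P.homology 0) (P.homology 0) 1))
    (hQM : ∀ f : P.homology (-1) ⟶ P.homology 0, f = 0)
    {X : ModuleCat.{0} R} [Module.Finite R X]
    (hX : Subsingleton (Ext (P.homology 0) X 1)) (hQX : ∀ f : P.homology (-1) ⟶ X, f = 0) :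
    ∃ (n : ℕ) (f : (⨁ fun _ : Fin n => P.homology 0) ⟶ X), Epi f ∧
      Module.Finite R (kernel f : ModuleCat.{0} R) ∧
      Subsingleton (Ext (P.homology 0) (kernel f) 1) ∧
      ∀ g : P.homology (-1) ⟶ (kernel f : ModuleCat.{0} R), g = 0 := by
  have : IsNoetherianRing R := isNoetherian_of_tower k inferInstance
  have := hP.1.2.1 0
  have := finite_homology P 0
  obtain ⟨n, f, hf⟩ := exists_hom_biproduct_precomp_surjective k (P.homology 0) X
  have := finite_biproduct n (P.homology 0)
  have hMn := subsingleton_ext_biproduct n 1 hM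
  have hC : IsZero (cokernel f) := by
    refine isZero_of_hom_shift_eq_zero hP fun i => ?_
    rw [← hTP]
    refine hom_eq_zero_of_triangle hT e₁ e₃ i (Iso.refl _) (fun j hj => ?_) (fun j hj => ?_)
    · obtain _ | _ | j := j
      · exact Ext.homEquiv₀.subsingleton_congr.2
          (subsingleton_of_forall_eq 0 (hom_cokernel_eq_zero f hf hMn))
      · exact subsingleton_ext_one_of_epi (cokernel.π f) hX
      · exact HasProjectiveDimensionLT.subsingleton _ 2 _ (by lia) _
    · obtain _ | j := j
      · refine Ext.homEquiv₀.subsingleton_congr.2 (subsingleton_of_forall_eq 0 fun g => ?_)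
        rw [← Projective.factorThru_comp g (cokernel.π f), hQX (Projective.factorThru _ _),
          zero_comp]
      · exact HasProjectiveDimensionLT.subsingleton _ 1 _ (by lia) _
  have : Epi f := Preadditive.epi_of_isZero_cokernel f hC
  refine ⟨n, f, this, finite_of_mono (kernel.ι f), subsingleton_ext_one_kernel f hf hMn,
    fun g => ?_⟩
  rw [← cancel_mono (kernel.ι f), zero_comp]
  exact biproduct.hom_ext _ _ fun j => (hQM _).trans zero_comp.symm

end Silting

/-- Let `gl.dim A ≤ d` and let `P` be a 2-term silting complex with
`pd H^0(P) ≤ 1`, so that `Q = H^{-1}(P)` is projective. If `tQ` is the torsion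
submodule of `Q` w.r.t. `(T(P), F(P))`, then
`tQ ∈ add H^0(P) * add H^0(P)[1] * ⋯ * add H^0(P)[d-1]`. -/
theorem torsion_of_Hneg1_mem_starChain
    (k A : Type) [Field k] [Ring A] [Algebra k A] [FiniteDimensional k A]
    [HasDerivedCategory.{w} (ModuleCat.{0} Aᵐᵒᵖ)]
    (P : CochainComplex (ModuleCat.{0} Aᵐᵒᵖ) ℤ)
    (hP : IsTwoTermSilting Aᵐᵒᵖ P)
    (d : ℕ) (hgld : gldLE.{0, 0} Aᵐᵒᵖ d)
    (hH0 : pdLE.{0, 0} Aᵐᵒᵖ 1 (P.homology 0))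
    -- `t` is the torsion submodule of `Q = H^{-1}(P)` w.r.t. `(T(P), F(P))`:
    (t : Submodule Aᵐᵒᵖ ↥(P.homology (-1)))
    (ht_tors : ModuleCat.of Aᵐᵒᵖ ↥t ∈ TT P)
    (ht_cotors : ModuleCat.of Aᵐᵒᵖ (↥(P.homology (-1)) ⧸ t) ∈ FF P) :
    (DerivedCategory.singleFunctor (ModuleCat.{0} Aᵐᵒᵖ) 0).obj (ModuleCat.of Aᵐᵒᵖ ↥t) ∈
      starChain
        (fun i => shiftSet
          (addOf ((DerivedCategory.singleFunctor (ModuleCat.{0} Aᵐᵒᵖ) 0).obj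
            (P.homology 0))) (i : ℤ))
        (d - 1) := by
  have : HasExt.{w} (ModuleCat.{0} Aᵐᵒᵖ) := hasExt_of_hasDerivedCategory _
  have : Module.Finite k Aᵐᵒᵖ := Module.Finite.equiv (MulOpposite.opLinearEquiv k)
  have : IsNoetherianRing Aᵐᵒᵖ := isNoetherian_of_tower k inferInstance
  have := hP.1.1
  have := hP.1.2.1
  have : HasProjectiveDimensionLT (P.homology 0) 2 := hasProjectiveDimensionLT_of_pdLE hH0
  have : Projective (P.homology (-1)) := projective_homology_of_projective P
    ((hP.1.2.2 (-2) (by lia) (by lia)).eq_of_src _ _)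
    ((hP.1.2.2 1 (by lia) (by lia)).eq_of_tgt _ _)
  have := finite_homology P (-1)
  obtain ⟨T, hT, e₁, e₃, hTP⟩ := exists_triangle_of_isTwoTermCplx hP.1
  have hM : ∀ f : T.obj₂ ⟶
      ((DerivedCategory.singleFunctor (ModuleCat.{0} Aᵐᵒᵖ) 0).obj (P.homology 0))⟦(1 : ℤ)⟧,
      f = 0 := fun f => by
    rw [← cancel_mono ((shiftFunctor _ (1 : ℤ)).map e₃.inv), zero_comp]
    exact hom_shift_obj₃_eq_zero hT e₁ e₃ (by rw [hTP]; exact hP.2.1) _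
  have ht : ∀ f : T.obj₂ ⟶ ((DerivedCategory.singleFunctor (ModuleCat.{0} Aᵐᵒᵖ) 0).obj
      (ModuleCat.of Aᵐᵒᵖ ↥t))⟦(1 : ℤ)⟧, f = 0 := by
    rw [hTP]
    exact ht_tors.2
  have hpd : HasProjectiveDimensionLT (ModuleCat.of Aᵐᵒᵖ ↥t) (d - 1 + 1) := by
    have hS : (ShortComplex.mk (ModuleCat.ofHom t.subtype) (ModuleCat.ofHom t.mkQ)
        (by ext; simp)).ShortExact := {
      exact := by
        rw [ShortComplex.moduleCat_exact_iff_range_eq_ker]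
        simp
      mono_f := (ModuleCat.mono_iff_injective _).2 t.injective_subtype
      epi_g := (ModuleCat.epi_iff_surjective _).2 t.mkQ_surjective }
    have h : HasProjectiveDimensionLT (ModuleCat.of Aᵐᵒᵖ (↥(P.homology (-1)) ⧸ t)) (d + 1) :=
      hasProjectiveDimensionLT_of_pdLE (hgld _ inferInstance)
    exact hS.hasProjectiveDimensionLT_X₁ _ (hasProjectiveDimensionLT_of_ge _ 1 _ (by lia))
      (hasProjectiveDimensionLT_of_ge _ (d + 1) _ (by lia))
  have key := shift_mem_starChain_of_approx
    (fun X : ModuleCat.{0} Aᵐᵒᵖ => Module.Finite Aᵐᵒᵖ X ∧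
      Subsingleton (Abelian.Ext (P.homology 0) X 1) ∧
      ∀ f : P.homology (-1) ⟶ X, f = 0) (fun X hX => hX.2.1)
    (fun X ⟨_, h, h'⟩ => exists_epi_of_isTwoTermSilting k hP hT e₁ e₃ hTP
      (subsingleton_ext_of_hom_eq_zero hT e₁ e₃ hM) (hom_eq_zero_of_hom_eq_zero hT e₁ e₃ hM) h h')
    (d - 1) (ModuleCat.of Aᵐᵒᵖ ↥t)
    ⟨ht_tors.1, subsingleton_ext_of_hom_eq_zero hT e₁ e₃ ht,
      hom_eq_zero_of_hom_eq_zero hT e₁ e₃ ht⟩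
    (fun Y _ => HasProjectiveDimensionLT.subsingleton _ (d - 1 + 1) _ le_rfl Y) 0
  simp only [zero_add] at key
  exact mem_starChain_of_iso ((shiftFunctorZero _ ℤ).app _) key

end

end TwoTermSilting
end

section
/- Let A have global dimension at most 2, let P be a 2-term silting complex in K^b(proj A) and B = End_D(P). If X lies in 𝒫_C^{[0,1]} = (𝒫 * 𝒫[1]) ∩ C(P), then the B-module Hom_D(P, X) has projective dimension at most 1. -/
/-!
Common setup: we model right `A`-modules as `ModuleCat Aᵐᵒᵖ`, the bounded derived
category `D^b(mod A)` as the full subcategory (given by the predicate `InDb`) of the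
derived category of `Mod Aᵐᵒᵖ` consisting of cohomologically bounded complexes with
finitely generated cohomology, and `K^b(proj A)` via bounded complexes of finitely
generated projective modules (`IsPerfCplx`).
-/

namespace TwoTermSilting

open CategoryTheory Limits Pretriangulated

universe w v u

noncomputable section

section PostcompLinear

variable {C : Type u} [Category.{v} C] [Preadditive C]

/-- Postcomposition with `f`, as a morphism of right `End P`-modules. -/
def postcompLinear (P : C) {X Y : C} (f : X ⟶ Y) : (P ⟶ X) →ₗ[(End P)ᵐᵒᵖ] (P ⟶ Y) where
  toFun φ := φ ≫ f
  map_add' _ _ := Preadditive.add_comp _ _ _ _ _ _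
  map_smul' b φ := Category.assoc b.unop φ f

@[simp]
lemma postcompLinear_apply (P : C) {X Y : C} (f : X ⟶ Y) (φ : P ⟶ X) :
    postcompLinear P f φ = φ ≫ f := rfl

end PostcompLinear

section AddOf

variable {C : Type u} [Category.{v} C] [HasZeroObject C] [Preadditive C] [HasShift C ℤ]
  [∀ n : ℤ, (shiftFunctor C n).Additive] [Pretriangulated C]

lemma addOf_of_iso {P X Y : C} (e : X ≅ Y) (hX : X ∈ addOf P) : Y ∈ addOf P := by
  obtain ⟨n, i, r, h⟩ := hX
  exact ⟨n, e.inv ≫ i, r ≫ e.hom, by simp [reassoc_of% h]⟩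

lemma projective_hom_of_mem_addOf {P Y : C} (hY : Y ∈ addOf P) :
    Module.Projective (End P)ᵐᵒᵖ (P ⟶ Y) := by
  obtain ⟨n, i, r, h⟩ := hY
  let s : (P ⟶ Y) →ₗ[(End P)ᵐᵒᵖ] (Fin n → (End P)ᵐᵒᵖ) :=
    { toFun φ j := MulOpposite.op (φ ≫ i ≫ biproduct.π (fun _ : Fin n => P) j)
      map_add' φ ψ := by
        ext j
        exact congrArg MulOpposite.op (Preadditive.add_comp _ _ _ φ ψ _)
      map_smul' b φ := by
        ext j
        exact congrArg MulOpposite.op (Category.assoc b.unop φ _) }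
  let t : (Fin n → (End P)ᵐᵒᵖ) →ₗ[(End P)ᵐᵒᵖ] (P ⟶ Y) :=
    { toFun v := biproduct.lift (fun j => (v j).unop) ≫ r
      map_add' v w := by
        rw [← Preadditive.add_comp]
        congr 1
        ext j
        rw [Preadditive.add_comp]
        simp only [biproduct.lift_π]
        rfl
      map_smul' b v := by
        refine Eq.trans ?_ (Category.assoc b.unop _ _)
        congr 1
        ext j
        rw [Category.assoc]
        simp only [biproduct.lift_π]
        rfl }
  refine Module.Projective.of_split s t (LinearMap.ext fun φ => ?_)
  have : biproduct.lift (fun j => φ ≫ i ≫ biproduct.π (fun _ : Fin n => P) j) = φ ≫ i := by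
    ext j
    simp
  change biproduct.lift (fun j => φ ≫ i ≫ biproduct.π (fun _ : Fin n => P) j) ≫ r = φ
  rw [this, Category.assoc, h, Category.comp_id]

lemma hom_shift_eq_zero_of_mem_addOf {P Y : C} {n : ℤ} (hP : ∀ f : P ⟶ P⟦n⟧, f = 0)
    (hY : Y ∈ addOf P) (f : P ⟶ Y⟦n⟧) : f = 0 := by
  obtain ⟨m, i, r, h⟩ := hY
  have hid : 𝟙 (⨁ fun _ : Fin m => P) = ∑ j, biproduct.π _ j ≫ biproduct.ι _ j :=
    biproduct.total.symm
  have : f = f ≫ (i ≫ 𝟙 _ ≫ r)⟦n⟧' := by simp [h]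
  rw [this, hid]
  simp only [Preadditive.sum_comp, Preadditive.comp_sum, Functor.map_sum, Functor.map_comp,
    Category.assoc]
  refine Finset.sum_eq_zero fun j _ => ?_
  have h0 := hP (f ≫ i⟦n⟧' ≫ (biproduct.π (fun _ : Fin m => P) j)⟦n⟧')
  simpa using congrArg (· ≫ (biproduct.ι (fun _ : Fin m => P) j)⟦n⟧' ≫ r⟦n⟧') h0

/-- If `X ∈ add P * (add P)[1]` and `Hom(P, P[1]) = 0 = Hom(P, X[-1])`, then `Hom(P, X)` has
projective dimension at most `1` over `End P`. -/
theorem pdLE_one_hom_of_mem_star {P X : C} (hP : ∀ f : P ⟶ P⟦(1 : ℤ)⟧, f = 0)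
    (hX : X ∈ star (addOf P) (shiftSet (addOf P) 1)) (hX' : ∀ f : P ⟶ X⟦(-1 : ℤ)⟧, f = 0) :
    pdLE.{v, v} (End P)ᵐᵒᵖ 1 (ModuleCat.of (End P)ᵐᵒᵖ (P ⟶ X)) := by
  obtain ⟨P₀, Y, f, g, h, hP₀, ⟨P₁, hP₁, ⟨e⟩⟩, hT⟩ := hX
  have hT' := inv_rot_of_distTriang _ hT
  have hT'' := inv_rot_of_distTriang _ hT'
  have hY : Y⟦(-1 : ℤ)⟧ ∈ addOf P :=
    addOf_of_iso ((shiftShiftNeg P₁ (1 : ℤ)).symm ≪≫ (shiftFunctor C (-1 : ℤ)).mapIso e.symm) hP₁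
  have hPY (φ : P ⟶ Y) : φ = 0 := by
    rw [← cancel_mono e.hom, zero_comp]
    exact hom_shift_eq_zero_of_mem_addOf hP hP₁ _
  let k : Y⟦(-1 : ℤ)⟧ ⟶ P₀ := (Triangle.mk f g h).invRotate.mor₁
  have hkf : k ≫ f = 0 := comp_distTriang_mor_zero₁₂ _ hT'
  have hk_inj : Function.Injective (postcompLinear P k) := by
    rw [injective_iff_map_eq_zero]
    intro φ hφ
    obtain ⟨ψ, rfl⟩ := Triangle.coyoneda_exact₂ _ hT'' φ hφ
    rw [hX' ψ]
    exact zero_comp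
  have hf_surj : Function.Surjective (postcompLinear P f) := fun φ => by
    obtain ⟨ψ, hψ⟩ := Triangle.coyoneda_exact₂ _ hT φ (hPY _)
    exact ⟨ψ, hψ.symm⟩
  have hexact : LinearMap.range (postcompLinear P k) = LinearMap.ker (postcompLinear P f) := by
    ext φ
    simp only [LinearMap.mem_range, LinearMap.mem_ker]
    constructor
    · rintro ⟨ψ, rfl⟩
      simp [hkf]
    · intro hφ
      obtain ⟨ψ, hψ⟩ := Triangle.coyoneda_exact₂ _ hT' φ hφ
      exact ⟨ψ, hψ.symm⟩
  have hprojP₀ := projective_hom_of_mem_addOf hP₀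
  have hprojY := projective_hom_of_mem_addOf hY
  have hprojKer : Module.Projective (End P)ᵐᵒᵖ (LinearMap.ker (postcompLinear P f)) :=
    Module.Projective.of_equiv ((LinearEquiv.ofInjective _ hk_inj).trans
      (LinearEquiv.ofEq _ _ hexact))
  refine ⟨ModuleCat.of _ (P ⟶ P₀), ModuleCat.ofHom (postcompLinear P f),
    (IsProjective.iff_projective _).1 hprojP₀, (ModuleCat.epi_iff_surjective _).2 hf_surj, ?_⟩
  exact Projective.of_iso (ModuleCat.kernelIsoKer (ModuleCat.ofHom (postcompLinear P f))).symm
    ((IsProjective.iff_projective _).1 hprojKer)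

end AddOf

/-- Let `gl.dim A ≤ 2`, let `P` be a 2-term silting complex and
`B = End_D(P)`. If `X ∈ 𝒫_C^{[0,1]} = (𝒫 * 𝒫[1]) ∩ C(P)`, then the right `B`-module
`Hom_D(P, X)` has projective dimension at most `1`. -/
theorem pd_hom_le_one_of_mem_PC01
    (k A : Type) [Field k] [Ring A] [Algebra k A] [FiniteDimensional k A]
    [HasDerivedCategory.{w} (ModuleCat.{0} Aᵐᵒᵖ)]
    (P : CochainComplex (ModuleCat.{0} Aᵐᵒᵖ) ℤ)
    (hP : IsTwoTermSilting Aᵐᵒᵖ P)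
    (hgld : gldLE.{0, 0} Aᵐᵒᵖ 2)
    (X : DerivedCategory (ModuleCat.{0} Aᵐᵒᵖ))
    (hX : X ∈ star (addOf (DerivedCategory.Q.obj P))
        (shiftSet (addOf (DerivedCategory.Q.obj P)) 1) ∩ CP P) :
    pdLE.{w, w} (End (DerivedCategory.Q.obj P))ᵐᵒᵖ 1
      (ModuleCat.of (End (DerivedCategory.Q.obj P))ᵐᵒᵖ
        (DerivedCategory.Q.obj P ⟶ X)) :=
  pdLE_one_hom_of_mem_star hP.2.1 hX.1 (hX.2.2 (-1) (by decide))

end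

end TwoTermSilting
end

section
/- Let A have global dimension at most 2, let P be a 2-term silting complex in K^b(proj A) and B = End_D(P). If X lies in C(P) ∩ (𝒫_C^{[0,1]} * 𝒫_C^{[0,1]}[1] * 𝒫_C^{[0,1]}[2]), then the B-module Hom_D(P, X) has projective dimension at most 3. -/
/-!
Common setup: we model right `A`-modules as `ModuleCat Aᵐᵒᵖ`, the bounded derived
category `D^b(mod A)` as the full subcategory (given by the predicate `InDb`) of the
derived category of `Mod Aᵐᵒᵖ` consisting of cohomologically bounded complexes with
finitely generated cohomology, and `K^b(proj A)` via bounded complexes of finitely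
generated projective modules (`IsPerfCplx`).
-/

namespace TwoTermSilting

open CategoryTheory Limits Pretriangulated

universe w v u

noncomputable section

lemma pdLE_of_hasProjectiveDimensionLE {R : Type u} [Ring R] (n : ℕ) (M : ModuleCat.{u} R)
    (h : HasProjectiveDimensionLE M n) : pdLE R n M := by
  induction n generalizing M with
  | zero => exact (projective_iff_hasProjectiveDimensionLE_zero M).2 h
  | succ n ih =>
    refine ⟨Projective.over M, Projective.π M, inferInstance, inferInstance, ih _ ?_⟩
    have hS : (ShortComplex.mk (kernel.ι (Projective.π M)) (Projective.π M)
        (kernel.condition _)).ShortExact :=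
      { exact := ShortComplex.exact_of_f_is_kernel _ (kernelIsKernel _) }
    exact (hS.hasProjectiveDimensionLT_X₃_iff n inferInstance).1 h

section Hom

variable {C : Type u} [Category.{v} C] [Preadditive C]

lemma projective_biproduct {J : Type*} (X : J → C) [HasBiproduct X] [∀ j, Projective (X j)] :
    Projective (⨁ X) where
  factors f e _ := ⟨biproduct.desc fun j ↦ Projective.factorThru (biproduct.ι X j ≫ f) e, by
    ext; simp⟩

lemma projective_coyonedaObj_self (P : C) :
    Projective ((preadditiveCoyonedaObj P).obj P) := by
  have : Module.Projective (End P)ᵐᵒᵖ (P ⟶ P) :=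
    Module.Projective.of_equiv (Preadditive.homSelfLinearEquivEndMulOpposite P).symm
  exact (IsProjective.iff_projective (R := (End P)ᵐᵒᵖ) (P ⟶ P)).1 this

lemma coyonedaObj_map_mono {P Y Z : C} (g : Y ⟶ Z) (hg : ∀ f : P ⟶ Y, f ≫ g = 0 → f = 0) :
    Mono ((preadditiveCoyonedaObj P).map g) := by
  rw [ModuleCat.mono_iff_injective]
  exact (injective_iff_map_eq_zero ((preadditiveCoyonedaObj P).map g).hom).2 hg

lemma coyonedaObj_map_epi {P Y Z : C} (g : Y ⟶ Z) (hg : ∀ f : P ⟶ Z, ∃ f' : P ⟶ Y, f = f' ≫ g) :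
    Epi ((preadditiveCoyonedaObj P).map g) := by
  rw [ModuleCat.epi_iff_surjective]
  exact fun f ↦ (hg f).imp fun _ h ↦ h.symm

lemma hasProjectiveDimensionLT_coyonedaObj_of_bijective {P Y Z : C} (g : Y ⟶ Z) (n : ℕ)
    (hinj : ∀ f : P ⟶ Y, f ≫ g = 0 → f = 0) (hsurj : ∀ f : P ⟶ Z, ∃ f' : P ⟶ Y, f = f' ≫ g)
    (hY : HasProjectiveDimensionLT ((preadditiveCoyonedaObj P).obj Y) n) :
    HasProjectiveDimensionLT ((preadditiveCoyonedaObj P).obj Z) n := by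
  have := coyonedaObj_map_mono g hinj
  have := coyonedaObj_map_epi g hsurj
  have := isIso_of_mono_of_epi ((preadditiveCoyonedaObj P).map g)
  exact hasProjectiveDimensionLT_of_iso (asIso ((preadditiveCoyonedaObj P).map g)) n

lemma exact_coyonedaObj_map {P X Y Z : C} (a : X ⟶ Y) (b : Y ⟶ Z)
    (w : (preadditiveCoyonedaObj P).map a ≫ (preadditiveCoyonedaObj P).map b = 0)
    (h : ∀ f : P ⟶ Y, f ≫ b = 0 → ∃ g : P ⟶ X, f = g ≫ a) :
    (ShortComplex.mk _ _ w).Exact := by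
  rw [ShortComplex.moduleCat_exact_iff]
  exact fun f hf ↦ (h f hf).imp fun _ h ↦ h.symm

/-- If `0 ⟶ (P, W) ⟶ (P, X) ⟶ (P, Y) ⟶ (P, Z) ⟶ 0` is exact, then the projective dimension of
the last term is bounded in terms of the three others. -/
lemma hasProjectiveDimensionLT_coyonedaObj_of_exact {P W X Y Z : C} (d : W ⟶ X) (a : X ⟶ Y)
    (b : Y ⟶ Z) (hda : d ≫ a = 0) (hab : a ≫ b = 0)
    (hd : ∀ f : P ⟶ W, f ≫ d = 0 → f = 0)
    (ha : ∀ f : P ⟶ X, f ≫ a = 0 → ∃ g : P ⟶ W, f = g ≫ d)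
    (hb : ∀ f : P ⟶ Y, f ≫ b = 0 → ∃ g : P ⟶ X, f = g ≫ a)
    (hsurj : ∀ f : P ⟶ Z, ∃ g : P ⟶ Y, f = g ≫ b) (n : ℕ)
    (hW : HasProjectiveDimensionLT ((preadditiveCoyonedaObj P).obj W) n)
    (hX : HasProjectiveDimensionLT ((preadditiveCoyonedaObj P).obj X) (n + 1))
    (hY : HasProjectiveDimensionLT ((preadditiveCoyonedaObj P).obj Y) (n + 2)) :
    HasProjectiveDimensionLT ((preadditiveCoyonedaObj P).obj Z) (n + 2) := by
  let F := preadditiveCoyonedaObj P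
  have : Mono (F.map d) := coyonedaObj_map_mono d hd
  have : Epi (F.map b) := coyonedaObj_map_epi b hsurj
  have w : F.map d ≫ F.map a = 0 := by rw [← F.map_comp, hda, F.map_zero]
  have w' : F.map a ≫ F.map b = 0 := by rw [← F.map_comp, hab, F.map_zero]
  let q : F.obj X ⟶ kernel (F.map b) := kernel.lift _ (F.map a) w'
  have hq : F.map d ≫ q = 0 := by
    rw [← cancel_mono (kernel.ι (F.map b)), Category.assoc, kernel.lift_ι, w, zero_comp]
  have : Epi q := (ShortComplex.exact_iff_epi_kernel_lift (ShortComplex.mk _ _ w')).1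
    (exact_coyonedaObj_map a b w' hb)
  let φ : ShortComplex.mk _ q hq ⟶ ShortComplex.mk _ _ w :=
    { τ₁ := 𝟙 _
      τ₂ := 𝟙 _
      τ₃ := kernel.ι (F.map b)
      comm₁₂ := (Category.id_comp _).trans (Category.comp_id _).symm
      comm₂₃ := (Category.id_comp _).trans (kernel.lift_ι _ _ _).symm }
  have hS : (ShortComplex.mk _ q hq).ShortExact :=
    { exact := by
        have : Epi φ.τ₁ := inferInstanceAs (Epi (𝟙 _))
        have : IsIso φ.τ₂ := inferInstanceAs (IsIso (𝟙 _))
        have : Mono φ.τ₃ := inferInstanceAs (Mono (kernel.ι _))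
        exact (ShortComplex.exact_iff_of_epi_of_isIso_of_mono φ).2
          (exact_coyonedaObj_map d a w ha) }
  have hS' : (ShortComplex.mk (kernel.ι (F.map b)) (F.map b) (kernel.condition _)).ShortExact :=
    { exact := ShortComplex.exact_of_f_is_kernel _ (kernelIsKernel _) }
  exact hS'.hasProjectiveDimensionLT_X₃ (n + 1) (hS.hasProjectiveDimensionLT_X₃ n hW hX) hY

lemma hom_eq_zero_of_iso_s18 {P Y Z : C} (e : Y ≅ Z) (hZ : ∀ f : P ⟶ Z, f = 0) (f : P ⟶ Y) :
    f = 0 := by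
  rw [← cancel_mono e.hom, hZ (f ≫ e.hom), zero_comp]

lemma hom_eq_zero_of_exists_factor {P Y Z : C} {d : Y ⟶ Z} (hY : ∀ f : P ⟶ Y, f = 0) {f : P ⟶ Z}
    (hf : ∃ g : P ⟶ Y, f = g ≫ d) : f = 0 := by
  obtain ⟨g, rfl⟩ := hf
  rw [hY g, zero_comp]

/-- The `P`-cohomology of `X` is concentrated in degree `n`. -/
def HomConcentrated [HasShift C ℤ] (P X : C) (n : ℤ) : Prop :=
  ∀ i : ℤ, i ≠ n → ∀ f : P ⟶ X⟦i⟧, f = 0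

namespace HomConcentrated

variable [HasShift C ℤ] {P X Y : C} {n : ℤ}

lemma of_iso (h : HomConcentrated P X n) (e : Y ≅ X) : HomConcentrated P Y n :=
  fun i hi ↦ hom_eq_zero_of_iso_s18 ((shiftFunctor C i).mapIso e) (h i hi)

lemma shift (h : HomConcentrated P X n) (m k : ℤ) (hk : k + m = n) :
    HomConcentrated P (X⟦m⟧) k :=
  fun i hi ↦ hom_eq_zero_of_iso_s18 ((shiftFunctorAdd' C m i (m + i) rfl).symm.app X)
    (h _ (by lia))

lemma hom_eq_zero (h : HomConcentrated P X n) (hn : n ≠ 0) (f : P ⟶ X) : f = 0 :=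
  hom_eq_zero_of_iso_s18 ((shiftFunctorZero C ℤ).symm.app X) (h 0 hn.symm) f

end HomConcentrated

end Hom

section Triangulated

open ZeroObject

variable {C : Type u} [Category.{v} C] [HasZeroObject C] [Preadditive C] [HasShift C ℤ]
  [∀ n : ℤ, (shiftFunctor C n).Additive] [Pretriangulated C] {P : C}

lemma projective_coyonedaObj_of_mem_addOf {Y : C} (hY : Y ∈ addOf P) :
    Projective ((preadditiveCoyonedaObj P).obj Y) := by
  obtain ⟨n, i, r, hir⟩ := hY
  have := projective_coyonedaObj_self P
  have := Functor.preservesFiniteBiproductsOfAdditive (preadditiveCoyonedaObj P)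
  have : Projective ((preadditiveCoyonedaObj P).obj (⨁ fun _ : Fin n ↦ P)) :=
    Projective.of_iso ((preadditiveCoyonedaObj P).mapBiproduct _).symm
      (projective_biproduct fun _ : Fin n ↦ (preadditiveCoyonedaObj P).obj P)
  exact ((Retract.mk i r hir).map (preadditiveCoyonedaObj P)).projective

lemma hom_shift_one_eq_zero_of_mem_addOf (hP : ∀ f : P ⟶ P⟦(1 : ℤ)⟧, f = 0) {Y : C}
    (hY : Y ∈ addOf P) (f : P ⟶ Y⟦(1 : ℤ)⟧) : f = 0 := by
  obtain ⟨n, i, r, hir⟩ := hY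
  have := Functor.preservesFiniteBiproductsOfAdditive (shiftFunctor C (1 : ℤ))
  let e := (shiftFunctor C (1 : ℤ)).mapBiproduct (fun _ : Fin n ↦ P)
  have h : f ≫ i⟦1⟧' ≫ e.hom = 0 := by
    ext j
    rw [hP (_ ≫ _), zero_comp]
  have h' : f ≫ i⟦1⟧' = 0 := by
    rw [← cancel_mono e.hom, Category.assoc, h, zero_comp]
  rw [← Category.comp_id f, ← (shiftFunctor C (1 : ℤ)).map_id, ← hir, Functor.map_comp,
    reassoc_of% h', zero_comp]

lemma hasProjectiveDimensionLT_two_of_mem_star (hP : ∀ f : P ⟶ P⟦(1 : ℤ)⟧, f = 0) {Z : C}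
    (hZ : Z ∈ star (addOf P) (shiftSet (addOf P) 1)) (hZ' : HomConcentrated P Z 0) :
    HasProjectiveDimensionLT ((preadditiveCoyonedaObj P).obj Z) 2 := by
  obtain ⟨P₀, Q, f, g, h, hP₀, ⟨P₁, hP₁, ⟨e⟩⟩, hT⟩ := hZ
  let e₁ : Q⟦(-1 : ℤ)⟧ ≅ P₁ := (shiftFunctor C (-1 : ℤ)).mapIso e ≪≫ shiftShiftNeg P₁ (1 : ℤ)
  have hpQ := Projective.of_iso ((preadditiveCoyonedaObj P).mapIso e₁.symm)
    (projective_coyonedaObj_of_mem_addOf hP₁)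
  have hp₀ := projective_coyonedaObj_of_mem_addOf hP₀
  have hT' := inv_rot_of_distTriang _ hT
  have hT'' := inv_rot_of_distTriang _ hT'
  refine hasProjectiveDimensionLT_coyonedaObj_of_exact (P := P) (0 : (0 : C) ⟶ Q⟦(-1 : ℤ)⟧)
    (Triangle.mk f g h).invRotate.mor₁ f zero_comp (comp_distTriang_mor_zero₁₂ _ hT')
    (fun f _ ↦ (isZero_zero C).eq_zero_of_tgt f) (fun u hu ↦ ⟨0, ?_⟩)
    (Triangle.coyoneda_exact₂ _ hT') (fun u ↦ Triangle.coyoneda_exact₂ _ hT u ?_) 0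
    ((preadditiveCoyonedaObj P).map_isZero (isZero_zero C)).hasProjectiveDimensionLT_zero
    (projective_iff_hasProjectiveDimensionLT_one.1 hpQ)
    (hasProjectiveDimensionLT_of_ge ((preadditiveCoyonedaObj P).obj P₀) 1 2 (by lia))
  · rw [hom_eq_zero_of_exists_factor (hZ' (-1) (by lia)) (Triangle.coyoneda_exact₂ _ hT'' u hu),
      zero_comp]
  · exact hom_eq_zero_of_iso_s18 e (hom_shift_one_eq_zero_of_mem_addOf hP hP₁) _

/-- An object which is concentrated in degree zero and obtained by successive extensions of
`Z₀`, `Z₁⟦1⟧` and `Z₂⟦2⟧`, where the `Zᵢ` are concentrated in degree zero with Hom modules of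
projective dimension at most one, has Hom module of projective dimension at most three. -/
lemma hasProjectiveDimensionLT_four_of_distTriang {Z₀ W₁ W₂ X Y : C}
    {f : Z₀ ⟶ Y} {g : Y ⟶ W₁} {h : W₁ ⟶ Z₀⟦(1 : ℤ)⟧} (hT : Triangle.mk f g h ∈ distTriang C)
    {f' : Y ⟶ X} {g' : X ⟶ W₂} {h' : W₂ ⟶ Y⟦(1 : ℤ)⟧} (hT' : Triangle.mk f' g' h' ∈ distTriang C)
    (hX : HomConcentrated P X 0) (hZ₀ : HomConcentrated P Z₀ 0)
    (hW₁ : HomConcentrated P W₁ (-1)) (hW₂ : HomConcentrated P W₂ (-2))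
    (hp₀ : HasProjectiveDimensionLT ((preadditiveCoyonedaObj P).obj Z₀) 2)
    (hp₁ : HasProjectiveDimensionLT ((preadditiveCoyonedaObj P).obj (W₁⟦(-1 : ℤ)⟧)) 2)
    (hp₂ : HasProjectiveDimensionLT
      ((preadditiveCoyonedaObj P).obj ((W₂⟦(-1 : ℤ)⟧)⟦(-1 : ℤ)⟧)) 2) :
    HasProjectiveDimensionLT ((preadditiveCoyonedaObj P).obj X) 4 := by
  have hU₁ := inv_rot_of_distTriang _ hT
  have hU₂ := inv_rot_of_distTriang _ hU₁
  have hU₃ := inv_rot_of_distTriang _ hU₂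
  have hV₁ := inv_rot_of_distTriang _ hT'
  have hV₂ := inv_rot_of_distTriang _ hV₁
  have hV₃ := inv_rot_of_distTriang _ hV₂
  have hV₄ := inv_rot_of_distTriang _ hV₃
  have hV₅ := inv_rot_of_distTriang _ hV₄
  have hX' := hX.shift (-1) 1 (by lia)
  have hX'' := hX'.shift (-1) 2 (by lia)
  have hpY : HasProjectiveDimensionLT ((preadditiveCoyonedaObj P).obj (Y⟦(-1 : ℤ)⟧)) 2 := by
    exact hasProjectiveDimensionLT_coyonedaObj_of_bijective (P := P) _ 2
      (fun u hu ↦ hom_eq_zero_of_exists_factor (hX''.hom_eq_zero (by lia))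
        (Triangle.coyoneda_exact₂ _ hV₅ u hu))
      (fun u ↦ Triangle.coyoneda_exact₂ _ hV₄ u (hX'.hom_eq_zero (by lia) _)) hp₂
  refine hasProjectiveDimensionLT_coyonedaObj_of_bijective (P := P) f' 4 (fun u hu ↦ ?_)
    (fun u ↦ Triangle.coyoneda_exact₂ _ hT' u (hW₂.hom_eq_zero (by lia) _)) ?_
  · exact hom_eq_zero_of_exists_factor ((hW₂.shift (-1) (-1) (by lia)).hom_eq_zero (by lia))
      (Triangle.coyoneda_exact₂ _ hV₁ u hu)
  · refine hasProjectiveDimensionLT_coyonedaObj_of_exact (P := P)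
      (Triangle.mk f g h).invRotate.invRotate.mor₁ (Triangle.mk f g h).invRotate.mor₁ f
      (comp_distTriang_mor_zero₁₂ _ hU₂) (comp_distTriang_mor_zero₁₂ _ hU₁) (fun u hu ↦ ?_)
      (Triangle.coyoneda_exact₂ _ hU₂) (Triangle.coyoneda_exact₂ _ hU₁)
      (fun u ↦ Triangle.coyoneda_exact₂ _ hT u (hW₁.hom_eq_zero (by lia) _)) 2 hpY
      (hasProjectiveDimensionLT_of_ge ((preadditiveCoyonedaObj P).obj (W₁⟦(-1 : ℤ)⟧)) 2 3 (by lia))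
      (hasProjectiveDimensionLT_of_ge ((preadditiveCoyonedaObj P).obj Z₀) 2 4 (by lia))
    exact hom_eq_zero_of_exists_factor ((hZ₀.shift (-1) 1 (by lia)).hom_eq_zero (by lia))
      (Triangle.coyoneda_exact₂ _ hU₃ u hu)

end Triangulated

/-- Let `gl.dim A ≤ 2`, let `P` be a 2-term silting complex and
`B = End_D(P)`. If `X ∈ C(P) ∩ (𝒫_C^{[0,1]} * 𝒫_C^{[0,1]}[1] * 𝒫_C^{[0,1]}[2])`, where
`𝒫_C^{[0,1]} = (𝒫 * 𝒫[1]) ∩ C(P)`, then the right `B`-module `Hom_D(P, X)` has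
projective dimension at most `3`. -/
theorem pd_hom_le_three_of_mem_starChain_PC01
    (k A : Type) [Field k] [Ring A] [Algebra k A] [FiniteDimensional k A]
    [HasDerivedCategory.{w} (ModuleCat.{0} Aᵐᵒᵖ)]
    (P : CochainComplex (ModuleCat.{0} Aᵐᵒᵖ) ℤ)
    (hP : IsTwoTermSilting Aᵐᵒᵖ P)
    (hgld : gldLE.{0, 0} Aᵐᵒᵖ 2)
    (X : DerivedCategory (ModuleCat.{0} Aᵐᵒᵖ))
    (hX : X ∈ CP P)
    (hX' : X ∈ starChain
      (fun i => shiftSet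
        (star (addOf (DerivedCategory.Q.obj P))
          (shiftSet (addOf (DerivedCategory.Q.obj P)) 1) ∩ CP P) (i : ℤ)) 2) :
    pdLE.{w, w} (End (DerivedCategory.Q.obj P))ᵐᵒᵖ 3
      (ModuleCat.of (End (DerivedCategory.Q.obj P))ᵐᵒᵖ
        (DerivedCategory.Q.obj P ⟶ X)) := by
  let Q := DerivedCategory.Q.obj P
  have hCP {Z : DerivedCategory (ModuleCat.{0} Aᵐᵒᵖ)} (hZ : Z ∈ CP P) : HomConcentrated Q Z 0 :=
    hZ.2
  have hpd {Z : DerivedCategory (ModuleCat.{0} Aᵐᵒᵖ)}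
      (hZ : Z ∈ star (addOf Q) (shiftSet (addOf Q) 1) ∩ CP P) :
      HasProjectiveDimensionLT ((preadditiveCoyonedaObj Q).obj Z) 2 :=
    hasProjectiveDimensionLT_two_of_mem_star hP.2.1 hZ.1 (hCP hZ.2)
  obtain ⟨Y, W₂, f', g', h', ⟨W₀, W₁, f, g, h, ⟨Z₀, hZ₀, ⟨e₀⟩⟩, ⟨Z₁, hZ₁, ⟨e₁⟩⟩, hT⟩,
    ⟨Z₂, hZ₂, ⟨e₂⟩⟩, hT'⟩ := hX'
  let s (n : ℤ) := shiftFunctor (DerivedCategory (ModuleCat.{0} Aᵐᵒᵖ)) n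
  let i₀ : W₀ ≅ Z₀ := e₀ ≪≫ (shiftFunctorZero _ ℤ).app Z₀
  let i₁ : (s (-1)).obj W₁ ≅ Z₁ := (s (-1)).mapIso e₁ ≪≫ shiftShiftNeg Z₁ (1 : ℤ)
  let i₂ : (s (-1)).obj ((s (-1)).obj W₂) ≅ Z₂ :=
    (s (-1)).mapIso ((s (-1)).mapIso (e₂ ≪≫ (shiftFunctorAdd' _ 1 1 2 rfl).app Z₂) ≪≫
      shiftShiftNeg _ (1 : ℤ)) ≪≫ shiftShiftNeg _ (1 : ℤ)
  have hp {Z W : DerivedCategory (ModuleCat.{0} Aᵐᵒᵖ)} (e : W ≅ Z)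
      (hZ : Z ∈ star (addOf Q) (shiftSet (addOf Q) 1) ∩ CP P) :
      HasProjectiveDimensionLT ((preadditiveCoyonedaObj Q).obj W) 2 :=
    have := hpd hZ
    hasProjectiveDimensionLT_of_iso ((preadditiveCoyonedaObj Q).mapIso e.symm) 2
  exact pdLE_of_hasProjectiveDimensionLE 3 ((preadditiveCoyonedaObj Q).obj X)
    (hasProjectiveDimensionLT_four_of_distTriang hT hT' (hCP hX) ((hCP hZ₀.2).of_iso i₀)
      (((hCP hZ₁.2).shift 1 (-1) (by lia)).of_iso e₁)
      (((hCP hZ₂.2).shift 2 (-2) (by lia)).of_iso e₂) (hp i₀ hZ₀) (hp i₁ hZ₁) (hp i₂ hZ₂))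

end

end TwoTermSilting
end
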